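/- arXiv:2204.09174 — 2 statements merged into one kernel-verified Lean document; each statement's English description precedes it below -/
import Mathlib

section
/- Let w ∈ Sₙ be smooth (avoiding 3412 and 4231) and suppose w is right-almost-reducible at i, i.e., w = w^J w_J is a BP-decomposition with J = {s_i, …, s_{n−1}}, supp(w^J) ∩ J = {s_i}, s_i ∉ D_L(w) ∪ D_R(w), and w is Bruhat irreducible. Then: (1) max{w(1), …, w(i−1)} = i+1; (2) w(i) > i+1; and (3) the elements of {1, …, i+1} \ {w(1), …, w(i−1)} do not all appear in increasing order in w. -/
/-- The number of inversions (Coxeter length) of a permutation of `Fin n`. -/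
def invNum {n : ℕ} (w : Equiv.Perm (Fin n)) : ℕ :=
  (Finset.univ.filter (fun p : Fin n × Fin n => p.1 < p.2 ∧ w p.2 < w p.1)).card

/-- The simple transposition `s_i = (i, i+1)` in `S_{n+1}` (0-indexed). -/
def simpleS {n : ℕ} (i : Fin n) : Equiv.Perm (Fin (n + 1)) :=
  Equiv.swap i.castSucc i.succ

/-- `i` is a left descent of `w`. -/
def isLeftDescentS {n : ℕ} (w : Equiv.Perm (Fin (n + 1))) (i : Fin n) : Prop :=
  invNum (simpleS i * w) < invNum w

/-- `i` is a right descent of `w`. -/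
def isRightDescentS {n : ℕ} (w : Equiv.Perm (Fin (n + 1))) (i : Fin n) : Prop :=
  invNum (w * simpleS i) < invNum w

/-- The support of `w`: the simple transpositions appearing in some reduced word for `w`. -/
def suppS {n : ℕ} (w : Equiv.Perm (Fin (n + 1))) : Set (Fin n) :=
  {i | ∃ l : List (Fin n), w = (l.map simpleS).prod ∧ l.length = invNum w ∧ i ∈ l}

/-- The parabolic subgroup of `S_{n+1}` generated by the simple transpositions in `J`. -/
def parabolicS {n : ℕ} (J : Set (Fin n)) : Subgroup (Equiv.Perm (Fin (n + 1))) :=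
  Subgroup.closure (simpleS '' J)

/-- `w` is Bruhat irreducible: it has full support and admits no factorization into two
nontrivial factors with disjoint supports. -/
def bruhatIrreducibleS {n : ℕ} (w : Equiv.Perm (Fin (n + 1))) : Prop :=
  suppS w = Set.univ ∧
  ¬ ∃ w' w'' : Equiv.Perm (Fin (n + 1)),
      w = w' * w'' ∧ Disjoint (suppS w') (suppS w'') ∧ w' ≠ 1 ∧ w'' ≠ 1

/-- `w` is right-almost-reducible at `i`: the parabolic decomposition `w = w^J · w_J` with
`J = {s_i, …, s_{n-1}}` is a BP-decomposition, `supp(w^J) ∩ J = {s_i}`, and `s_i` is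
neither a left nor a right descent of `w`. -/
def rightAlmostReducibleS {n : ℕ} (w : Equiv.Perm (Fin (n + 1))) (i : Fin n) : Prop :=
  ∃ a b : Equiv.Perm (Fin (n + 1)),
    w = a * b ∧ b ∈ parabolicS {j | i ≤ j} ∧
    (∀ x ∈ parabolicS {j : Fin n | i ≤ j}, invNum a ≤ invNum (a * x)) ∧
    (suppS a ∩ {j | i ≤ j} ⊆ {j | isLeftDescentS b j}) ∧
    suppS a ∩ {j | i ≤ j} = {i} ∧
    ¬ isLeftDescentS w i ∧ ¬ isRightDescentS w i

/-- `w` is left-almost-reducible at `j` iff `w⁻¹` is right-almost-reducible at `j`. -/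
def leftAlmostReducibleS {n : ℕ} (w : Equiv.Perm (Fin (n + 1))) (j : Fin n) : Prop :=
  rightAlmostReducibleS w⁻¹ j

/-- `w` contains the pattern `p`. -/
def containsPattern {n k : ℕ} (w : Equiv.Perm (Fin n)) (p : Equiv.Perm (Fin k)) : Prop :=
  ∃ f : Fin k → Fin n, StrictMono f ∧ ∀ x y : Fin k, p x < p y ↔ w (f x) < w (f y)

/-- The inversion set of a permutation, as pairs of positions. -/
def inversionsS {n : ℕ} (w : Equiv.Perm (Fin n)) : Finset (Fin n × Fin n) :=
  Finset.univ.filter (fun p : Fin n × Fin n => p.1 < p.2 ∧ w p.2 < w p.1)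

theorem mem_inversionsS {n : ℕ} {w : Equiv.Perm (Fin n)} {p : Fin n × Fin n} :
    p ∈ inversionsS w ↔ p.1 < p.2 ∧ w p.2 < w p.1 := by
  simp [inversionsS]

theorem invNum_eq_card_inversionsS {n : ℕ} (w : Equiv.Perm (Fin n)) :
    invNum w = (inversionsS w).card := rfl

theorem invNum_inv {n : ℕ} (w : Equiv.Perm (Fin n)) : invNum w⁻¹ = invNum w := by
  refine Finset.card_bij (fun p _ => (w⁻¹ p.2, w⁻¹ p.1)) ?_ ?_ ?_
  · rintro ⟨p, q⟩ h
    simpa [and_comm] using h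
  · rintro ⟨p, q⟩ _ ⟨p', q'⟩ _ h
    simpa [and_comm] using h
  · rintro ⟨p, q⟩ h
    refine ⟨(w q, w p), ?_, by simp⟩
    simpa [and_comm] using h

theorem simpleS_mul_self {n : ℕ} (j : Fin n) : simpleS j * simpleS j = 1 :=
  Equiv.swap_mul_self _ _

theorem simpleS_apply_castSucc {n : ℕ} (j : Fin n) : simpleS j j.castSucc = j.succ :=
  Equiv.swap_apply_left _ _

theorem simpleS_apply_succ {n : ℕ} (j : Fin n) : simpleS j j.succ = j.castSucc :=
  Equiv.swap_apply_right _ _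

theorem simpleS_apply_of_ne {n : ℕ} {j : Fin n} {x : Fin (n + 1)}
    (h₁ : x ≠ j.castSucc) (h₂ : x ≠ j.succ) : simpleS j x = x :=
  Equiv.swap_apply_of_ne_of_ne h₁ h₂

theorem simpleS_inv {n : ℕ} (j : Fin n) : (simpleS j)⁻¹ = simpleS j :=
  Equiv.swap_inv _ _

theorem simpleS_lt_simpleS_iff {n : ℕ} (j : Fin n) (x y : Fin (n + 1)) :
    simpleS j x < simpleS j y ↔
      (x < y ∧ ¬ (x = j.castSucc ∧ y = j.succ)) ∨ (x = j.succ ∧ y = j.castSucc) := by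
  unfold simpleS
  simp only [Equiv.swap_apply_def]
  split_ifs <;> grind [Fin.val_castSucc]

theorem inversionsS_simpleS_mul {n : ℕ} {u : Equiv.Perm (Fin (n + 1))} {j : Fin n}
    (h : u⁻¹ j.castSucc < u⁻¹ j.succ) :
    inversionsS (simpleS j * u) = insert (u⁻¹ j.castSucc, u⁻¹ j.succ) (inversionsS u) := by
  ext ⟨p, q⟩
  simp only [Finset.mem_insert, mem_inversionsS, Equiv.Perm.mul_apply, simpleS_lt_simpleS_iff,
    Prod.mk.injEq, Equiv.Perm.eq_inv_iff_eq]
  constructor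
  · tauto
  · rintro (⟨hp, hq⟩ | ⟨hpq, hlt⟩)
    · rw [← Equiv.Perm.eq_inv_iff_eq] at hp hq
      subst hp hq
      simpa using h
    · refine ⟨hpq, Or.inl ⟨hlt, ?_⟩⟩
      rintro ⟨hq, hp⟩
      rw [← Equiv.Perm.eq_inv_iff_eq] at hp hq
      subst hp hq
      exact absurd h hpq.not_gt

theorem invNum_simpleS_mul {n : ℕ} {u : Equiv.Perm (Fin (n + 1))} {j : Fin n}
    (h : u⁻¹ j.castSucc < u⁻¹ j.succ) : invNum (simpleS j * u) = invNum u + 1 := by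
  rw [invNum_eq_card_inversionsS, inversionsS_simpleS_mul h, Finset.card_insert_of_notMem,
    invNum_eq_card_inversionsS]
  simp [mem_inversionsS, Fin.castSucc_lt_succ.le]

theorem invNum_simpleS_mul_add_one {n : ℕ} {u : Equiv.Perm (Fin (n + 1))} {j : Fin n}
    (h : u⁻¹ j.succ < u⁻¹ j.castSucc) : invNum (simpleS j * u) + 1 = invNum u := by
  have key := invNum_simpleS_mul (u := simpleS j * u) (j := j) (by
    simpa [simpleS_inv, simpleS_apply_castSucc, simpleS_apply_succ] using h)
  rw [← mul_assoc, simpleS_mul_self, one_mul] at key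
  exact key.symm

theorem isLeftDescentS_iff {n : ℕ} {u : Equiv.Perm (Fin (n + 1))} {j : Fin n} :
    isLeftDescentS u j ↔ u⁻¹ j.succ < u⁻¹ j.castSucc := by
  rcases lt_or_gt_of_ne (u⁻¹.injective.ne (Fin.castSucc_lt_succ (i := j)).ne) with h | h
  · simp only [isLeftDescentS, invNum_simpleS_mul h, h.not_gt, iff_false]
    omega
  · have := invNum_simpleS_mul_add_one h
    simp only [isLeftDescentS, h, iff_true]
    omega

theorem isRightDescentS_iff {n : ℕ} {u : Equiv.Perm (Fin (n + 1))} {j : Fin n} :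
    isRightDescentS u j ↔ u j.succ < u j.castSucc := by
  have h := isLeftDescentS_iff (u := u⁻¹) (j := j)
  rwa [inv_inv, isLeftDescentS, ← invNum_inv, mul_inv_rev, inv_inv, simpleS_inv, invNum_inv] at h

theorem invNum_prod_le_length {n : ℕ} (l : List (Fin n)) :
    invNum (l.map simpleS).prod ≤ l.length := by
  induction l with
  | nil =>
    have h : inversionsS (1 : Equiv.Perm (Fin (n + 1))) = ∅ := by
      ext p
      simpa [mem_inversionsS] using fun h => h.le
    simp [invNum_eq_card_inversionsS, h]
  | cons j l ih =>
    rw [List.map_cons, List.prod_cons, List.length_cons]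
    rcases lt_or_gt_of_ne ((l.map simpleS).prod⁻¹.injective.ne
      (Fin.castSucc_lt_succ (i := j)).ne) with h | h
    · rw [invNum_simpleS_mul h]
      omega
    · have := invNum_simpleS_mul_add_one h
      omega

/-- A reduced word has a reduced tail, and its first letter is an ascent of the tail. -/
theorem reduced_tail {n : ℕ} {j : Fin n} {l : List (Fin n)}
    (h : (j :: l).length = invNum ((j :: l).map simpleS).prod) :
    l.length = invNum (l.map simpleS).prod ∧
      (l.map simpleS).prod⁻¹ j.castSucc < (l.map simpleS).prod⁻¹ j.succ := by
  rw [List.map_cons, List.prod_cons, List.length_cons] at h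
  have hle := invNum_prod_le_length l
  rcases lt_or_gt_of_ne ((l.map simpleS).prod⁻¹.injective.ne
    (Fin.castSucc_lt_succ (i := j)).ne) with hj | hj
  · rw [invNum_simpleS_mul hj] at h
    exact ⟨by omega, hj⟩
  · have := invNum_simpleS_mul_add_one hj
    omega

theorem prod_apply_le_castSucc_iff {n : ℕ} {m : Fin n} {l : List (Fin n)} (h : m ∉ l)
    (x : Fin (n + 1)) : (l.map simpleS).prod x ≤ m.castSucc ↔ x ≤ m.castSucc := by
  induction l with
  | nil => simp
  | cons j l ih =>
    rw [List.mem_cons, not_or] at h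
    rw [List.map_cons, List.prod_cons, Equiv.Perm.mul_apply, ← ih h.2]
    generalize (l.map simpleS).prod x = y
    have hne := h.1
    unfold simpleS
    simp only [Equiv.swap_apply_def]
    split_ifs <;> grind [Fin.val_castSucc]

theorem exists_inversion_of_mem_reduced {n : ℕ} {m : Fin n} {l : List (Fin n)}
    (hl : l.length = invNum (l.map simpleS).prod) (hm : m ∈ l) :
    ∃ p q, p ≤ m.castSucc ∧ m.castSucc < q ∧
      (l.map simpleS).prod q < (l.map simpleS).prod p := by
  induction l with
  | nil => simp at hm
  | cons j l ih =>
    obtain ⟨hred, hasc⟩ := reduced_tail hl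
    have hinv := inversionsS_simpleS_mul hasc
    rw [List.map_cons, List.prod_cons]
    by_cases hml : m ∈ l
    · obtain ⟨p, q, hp, hq, hpq⟩ := ih hred hml
      refine ⟨p, q, hp, hq, ?_⟩
      have hmem : (p, q) ∈ inversionsS (simpleS j * (l.map simpleS).prod) := by
        rw [hinv]
        exact Finset.mem_insert_of_mem (mem_inversionsS.2 ⟨hp.trans_lt hq, hpq⟩)
      exact (mem_inversionsS.1 hmem).2
    · obtain rfl : m = j := by simpa [hml] using hm
      refine ⟨(l.map simpleS).prod⁻¹ m.castSucc, (l.map simpleS).prod⁻¹ m.succ, ?_, ?_, ?_⟩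
      · simp [← prod_apply_le_castSucc_iff hml]
      · rw [← not_le, ← prod_apply_le_castSucc_iff hml]
        simp
      · simp [simpleS_apply_castSucc, simpleS_apply_succ]

theorem exists_inversion_of_mem_suppS {n : ℕ} {a : Equiv.Perm (Fin (n + 1))} {m : Fin n}
    (h : m ∈ suppS a) : ∃ p q, p ≤ m.castSucc ∧ m.castSucc < q ∧ a q < a p := by
  obtain ⟨l, rfl, hl, hm⟩ := h
  exact exists_inversion_of_mem_reduced hl hm

/-- If every element of the support of `a` is at most `i`, and `i` occurs in it, then `a` fixes
everything beyond `i + 1`. -/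
theorem apply_eq_of_suppS_le {n : ℕ} {a : Equiv.Perm (Fin (n + 1))} {i : Fin n}
    (hi : i ∈ suppS a) (hle : ∀ j ∈ suppS a, j ≤ i) {x : Fin (n + 1)} (hx : i.succ < x) :
    a x = x := by
  obtain ⟨l, ha, hl, -⟩ := hi
  replace hle : ∀ j ∈ l, j ≤ i := fun j hj => hle j ⟨l, ha, hl, hj⟩
  subst ha
  clear hl
  induction l with
  | nil => rfl
  | cons j l ih =>
    rw [List.map_cons, List.prod_cons, Equiv.Perm.mul_apply,
      ih fun k hk => hle k (List.mem_cons_of_mem _ hk)]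
    have hj : j ≤ i := hle j List.mem_cons_self
    apply simpleS_apply_of_ne <;> grind [Fin.val_castSucc]

theorem apply_eq_of_mem_parabolicS {n : ℕ} {b : Equiv.Perm (Fin (n + 1))} {i : Fin n}
    (hb : b ∈ parabolicS {j | i ≤ j}) {x : Fin (n + 1)} (hx : x < i.castSucc) : b x = x := by
  induction hb using Subgroup.closure_induction with
  | mem u hu =>
    obtain ⟨j, hj, rfl⟩ := hu
    have hlt : x < j.castSucc := lt_of_lt_of_le hx (Fin.castSucc_le_castSucc_iff.2 hj)
    exact simpleS_apply_of_ne hlt.ne (hlt.trans Fin.castSucc_lt_succ).ne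
  | one => rfl
  | mul u v _ _ hu hv => rw [Equiv.Perm.mul_apply, hv, hu]
  | inv u _ hu => rw [Equiv.Perm.inv_eq_iff_eq, hu]

theorem disjoint_suppS {n : ℕ} {u v : Equiv.Perm (Fin (n + 1))} {i : Fin n}
    (hu : ∀ x, i.succ < x → u x = x) (hv : ∀ x, x ≤ i.castSucc → v x = x) :
    Disjoint (suppS u) (suppS v) := by
  rw [Set.disjoint_left]
  intro m hmu hmv
  rcases le_or_gt m i with hm | hm
  · obtain ⟨p, q, hp, hq, hpq⟩ := exists_inversion_of_mem_suppS hmv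
    have hpi : p ≤ i.castSucc := hp.trans hm
    rw [hv p hpi] at hpq
    have := v.injective (hv (v q) (hpq.le.trans hpi))
    grind
  · obtain ⟨p, q, hp, hq, hpq⟩ := exists_inversion_of_mem_suppS hmu
    have hqi : i.succ < q := by grind [Fin.lt_def]
    rw [hu q hqi] at hpq
    have := u.injective (hu (u p) (hqi.trans hpq))
    grind

/-- If `w ∈ S_{n+1}` is smooth (avoids 3412 and 4231; here 0-indexed as `(finRotate 4)^2` and
`swap 0 3`), Bruhat irreducible, and right-almost-reducible at `i`, then:
(1) the maximum of `w` on positions before `i` is the value `i+1` (0-indexed: `i.succ`);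
(2) `w(i) > i+1`; and
(3) the values in `{0,…,i+1}` not attained before position `i` do not appear in increasing
order in `w`. -/
theorem stmt17 {n : ℕ} (w : Equiv.Perm (Fin (n + 1))) (i : Fin n)
    (h3412 : ¬ containsPattern w ((finRotate 4) ^ 2))
    (h4231 : ¬ containsPattern w (Equiv.swap (0 : Fin 4) 3))
    (hirr : bruhatIrreducibleS w)
    (hrar : rightAlmostReducibleS w i) :
    ((∃ a : Fin (n + 1), a < i.castSucc ∧ w a = i.succ) ∧
      (∀ a : Fin (n + 1), a < i.castSucc → w a ≤ i.succ)) ∧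
    (i.succ < w i.castSucc) ∧
    (∃ p q : Fin (n + 1), p < q ∧
      (w p ≤ i.succ ∧ ∀ a : Fin (n + 1), a < i.castSucc → w a ≠ w p) ∧
      (w q ≤ i.succ ∧ ∀ a : Fin (n + 1), a < i.castSucc → w a ≠ w q) ∧
      w q < w p) := by
  obtain ⟨a, b, rfl, hb, hmin, hbp, hsupp, -, hright⟩ := hrar
  have hi : i ∈ suppS a ∩ {j | i ≤ j} := by simp [hsupp]
  have hdesc := isLeftDescentS_iff.1 (hbp hi)
  have hbfix : ∀ x, x < i.castSucc → b x = x := fun x hx => apply_eq_of_mem_parabolicS hb hx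
  have hafix : ∀ x, i.succ < x → a x = x := fun x hx => by
    refine apply_eq_of_suppS_le hi.1 (fun j hj => ?_) hx
    by_contra! hij
    have hmem : j ∈ suppS a ∩ {j | i ≤ j} := ⟨hj, hij.le⟩
    rw [hsupp] at hmem
    exact hij.ne' hmem
  have hale : ∀ x, x ≤ i.succ → a x ≤ i.succ := fun x hx => by
    by_contra! hlt
    have := a.injective (hafix _ hlt)
    grind
  have hcs : i.castSucc < i.succ := Fin.castSucc_lt_succ
  have hnext : ∀ x, i.castSucc < x → i.succ ≤ x := fun x hx => Fin.castSucc_lt_iff_succ_le.1 hx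
  have hasc : a i.castSucc < a i.succ := by
    have hnd : ¬ isRightDescentS a i :=
      (hmin _ (Subgroup.subset_closure ⟨i, le_refl i, rfl⟩)).not_gt
    rw [isRightDescentS_iff, not_lt] at hnd
    exact lt_of_le_of_ne hnd (a.injective.ne hcs.ne)
  have hlt : a i.succ < i.succ := by
    obtain ⟨p, q, hp, hq, hpq⟩ := exists_inversion_of_mem_suppS hi.1
    have hp' := hale p (hp.trans hcs.le)
    have := hnext q hq
    have := hafix q
    grind
  refine ⟨⟨⟨a⁻¹ i.succ, ?_⟩, fun x hx => ?_⟩, ?_, b⁻¹ i.succ, b⁻¹ i.castSucc, hdesc, ?_, ?_, ?_⟩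
  · have hpos : a⁻¹ i.succ < i.castSucc := by
      by_contra! h
      have happ : a (a⁻¹ i.succ) = i.succ := by simp
      have := hnext (a⁻¹ i.succ)
      have := hafix (a⁻¹ i.succ)
      grind
    exact ⟨hpos, by rw [Equiv.Perm.mul_apply, hbfix _ hpos]; simp⟩
  · rw [Equiv.Perm.mul_apply, hbfix x hx]
    exact hale x (hx.trans hcs).le
  · rw [Equiv.Perm.mul_apply]
    have hge : i.castSucc ≤ b i.castSucc := by
      by_contra! h
      have := b.injective (hbfix _ h)
      grind
    rcases hge.eq_or_lt with heq | hgt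
    · have hinv : b⁻¹ i.castSucc = i.castSucc := by rw [Equiv.Perm.inv_eq_iff_eq, ← heq]
      rw [hinv] at hdesc
      have := hbfix _ hdesc
      have happ : b (b⁻¹ i.succ) = i.succ := by simp
      grind
    rcases (hnext _ hgt).eq_or_lt with heq | hgt
    · refine absurd ⟨a * simpleS i, simpleS i * b, ?_, ?_, ?_, ?_⟩ hirr.2
      · rw [mul_assoc, ← mul_assoc (simpleS i), simpleS_mul_self, one_mul]
      · refine disjoint_suppS (i := i) (fun x hx => ?_) (fun x hx => ?_)
        · rw [Equiv.Perm.mul_apply, simpleS_apply_of_ne (hcs.trans hx).ne' hx.ne', hafix x hx]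
        · rw [Equiv.Perm.mul_apply]
          rcases hx.eq_or_lt with rfl | hx
          · rw [← heq, simpleS_apply_succ]
          · rw [hbfix x hx, simpleS_apply_of_ne hx.ne (hx.trans hcs).ne]
      · intro h
        have h₁ := congrArg (fun u => u i.castSucc) h
        simp only [Equiv.Perm.mul_apply, simpleS_apply_castSucc, Equiv.Perm.one_apply] at h₁
        have h₂ := congrArg (fun u => u i.succ) h
        simp only [Equiv.Perm.mul_apply, simpleS_apply_succ, Equiv.Perm.one_apply] at h₂
        grind
      · intro h
        have hbs : b = simpleS i := by
          rw [← simpleS_inv]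
          exact eq_inv_of_mul_eq_one_right h
        rw [isRightDescentS_iff, hbs] at hright
        simp only [Equiv.Perm.mul_apply, simpleS_apply_succ, simpleS_apply_castSucc] at hright
        exact hright hasc
    · rwa [hafix _ hgt]
  · refine ⟨by simpa using hlt.le, fun x hx h => ?_⟩
    have := (a * b).injective h
    rw [Equiv.Perm.eq_inv_iff_eq, hbfix x hx] at this
    grind
  · refine ⟨by simpa using (hasc.trans hlt).le, fun x hx h => ?_⟩
    have := (a * b).injective h
    rw [Equiv.Perm.eq_inv_iff_eq, hbfix x hx] at this
    grind
  · simpa using hasc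
end

section
/- Let J, J' ⊆ S be subsets of the simple reflections of a finite Coxeter group and let w = w₀(J)·w₀(J∩J')·w₀(J'), where w₀(K) denotes the longest element of the parabolic subgroup W_K. Then the product (w₀(J)w₀(J∩J'))·w₀(J') is length-additive, J' ⊆ D_R(w), and the parabolic decomposition of w with respect to J' is w^{J'} = w₀(J)w₀(J∩J') and w_{J'} = w₀(J'). -/
open CoxeterSystem

variable {B W : Type*} [Group W] {M : CoxeterMatrix B}

/-- One step of Bruhat order: multiply on the right by a reflection, increasing length. -/
def bruhatStep (cs : CoxeterSystem M W) (x y : W) : Prop :=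
  ∃ t : W, cs.IsReflection t ∧ y = x * t ∧ cs.length x < cs.length y

/-- Bruhat order on a Coxeter group. -/
def bruhatLE (cs : CoxeterSystem M W) : W → W → Prop :=
  Relation.ReflTransGen (bruhatStep cs)

/-- Strict Bruhat order. -/
def bruhatLT (cs : CoxeterSystem M W) (x y : W) : Prop :=
  bruhatLE cs x y ∧ x ≠ y

/-- Cover relation in Bruhat order. -/
def bruhatCovBy (cs : CoxeterSystem M W) (x y : W) : Prop :=
  bruhatLE cs x y ∧ cs.length y = cs.length x + 1

/-- The Bruhat interval `[u, v]`. -/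
def bruhatInterval (cs : CoxeterSystem M W) (u v : W) : Set W :=
  {x | bruhatLE cs u x ∧ bruhatLE cs x v}

/-- The support of `w`: simple reflections appearing in a reduced word for `w`. -/
def supp (cs : CoxeterSystem M W) (w : W) : Set B :=
  {i | ∃ ω : List B, cs.IsReduced ω ∧ w = cs.wordProd ω ∧ i ∈ ω}

/-- `a` is of minimal length in the coset `a · W_J`. -/
def IsMinCosetRep (cs : CoxeterSystem M W) (J : Set B) (a : W) : Prop :=
  ∀ x ∈ Subgroup.closure (cs.simple '' J), cs.length a ≤ cs.length (a * x)

/-- `x = a * b` is the parabolic decomposition of `x` with respect to `J`: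
`b ∈ W_J` and `a` is the minimal length coset representative `x^J`. -/
def IsPDecomp (cs : CoxeterSystem M W) (J : Set B) (x a b : W) : Prop :=
  x = a * b ∧ b ∈ Subgroup.closure (cs.simple '' J) ∧ IsMinCosetRep cs J a

/-- `w₀` is the longest element of the parabolic subgroup `W_K`. -/
def IsLongestIn (cs : CoxeterSystem M W) (K : Set B) (w₀ : W) : Prop :=
  w₀ ∈ Subgroup.closure (cs.simple '' K) ∧
    ∀ x ∈ Subgroup.closure (cs.simple '' K), cs.length x ≤ cs.length w₀

section GeometricRepresentation

variable (M) in
/-- The functional `v ↦ 2 ⟨αᵢ, v⟩` for the canonical bilinear form of a Coxeter matrix. -/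
noncomputable def simpleCoroot (i : B) : Module.Dual ℝ (B →₀ ℝ) :=
  Finsupp.linearCombination ℝ fun k ↦ -2 * Real.cos (Real.pi / M i k)

theorem simpleCoroot_single (i j : B) :
    simpleCoroot M i (Finsupp.single j 1) = -2 * Real.cos (Real.pi / M i j) := by
  simp [simpleCoroot]

theorem simpleCoroot_single_self (i : B) :
    simpleCoroot M i (Finsupp.single i 1) = 2 := by
  simp [simpleCoroot_single]

variable (M) in
/-- The reflection by which a simple generator acts in the geometric representation. -/
noncomputable def geomReflection (i : B) : (B →₀ ℝ) ≃ₗ[ℝ] (B →₀ ℝ) :=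
  Module.reflection (simpleCoroot_single_self (M := M) i)

open Polynomial.Chebyshev in
/-- The vanishing of Chebyshev polynomials which makes the product of two reflections, whose mirrors
meet at angle `π / m`, have order dividing `m`. -/
theorem chebyshev_S_eval_eq_zero {m : ℕ} (hm : 3 ≤ m) {t : ℝ}
    (ht : t = 2 * Real.cos (2 * Real.pi / m)) :
    (S ℝ (((m : ℤ) - 1) / 2)).eval t = 0 ∧ (S ℝ (((m : ℤ) - 2) / 2)).eval t = 0 ∨
    (S ℝ (((m : ℤ) - 1) / 2)).eval t + (S ℝ (((m : ℤ) - 3) / 2)).eval t = 0 ∧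
      (S ℝ ((m : ℤ) / 2)).eval t + (S ℝ (((m : ℤ) - 2) / 2)).eval t = 0 := by
  subst ht
  set θ : ℝ := 2 * Real.pi / m with hθ
  have hm' : (3 : ℝ) ≤ m := by exact_mod_cast hm
  have hmθ : m * θ = 2 * Real.pi := by rw [hθ]; field_simp
  have hsin : Real.sin θ ≠ 0 := by
    refine (Real.sin_pos_of_pos_of_lt_pi (by positivity) ?_).ne'
    nlinarith [Real.pi_pos]
  have hS (k : ℤ) := S_two_mul_real_cos θ k
  obtain ⟨k, hk | hk⟩ := Nat.even_or_odd' m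
  · left
    have e1 : ((m : ℤ) - 1) / 2 = k - 1 := by omega
    have e2 : ((m : ℤ) - 2) / 2 = k - 1 := by omega
    have : (S ℝ ((k : ℤ) - 1)).eval (2 * Real.cos θ) = 0 := by
      apply (mul_eq_zero_iff_right hsin).mp
      rw [hS, ← Real.sin_pi]
      congr 1
      rw [hk] at hmθ
      push_cast at hmθ ⊢
      linarith
    rw [e1, e2]
    exact ⟨this, this⟩
  · right
    have e1 : ((m : ℤ) - 1) / 2 = k := by omega
    have e2 : ((m : ℤ) - 2) / 2 = k - 1 := by omega
    have e3 : ((m : ℤ) - 3) / 2 = k - 1 := by omega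
    have e4 : (m : ℤ) / 2 = k := by omega
    have : (S ℝ (k : ℤ)).eval (2 * Real.cos θ) + (S ℝ ((k : ℤ) - 1)).eval (2 * Real.cos θ) = 0 := by
      apply (mul_eq_zero_iff_right hsin).mp
      rw [add_mul, hS, hS]
      have : ((k : ℤ) + 1 : ℝ) * θ = 2 * Real.pi - (((k : ℤ) - 1 : ℤ) + 1 : ℝ) * θ := by
        rw [hk] at hmθ
        push_cast at hmθ ⊢
        linarith
      rw [this, Real.sin_two_pi_sub]
      ring
    rw [e1, e2, e3, e4]
    exact ⟨this, this⟩

theorem geomReflection_isLiftable : M.IsLiftable (geomReflection M) := by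
  intro i j
  obtain rfl | hij := eq_or_ne i j
  · rw [M.diagonal, pow_one]
    refine LinearEquiv.ext fun v ↦ ?_
    rw [LinearEquiv.mul_apply, LinearEquiv.coe_one, id]
    exact Module.involutive_reflection _ v
  obtain h0 | h2 | h3 : M i j = 0 ∨ M i j = 2 ∨ 3 ≤ M i j := by
    have := M.off_diagonal i j hij
    omega
  · rw [h0, pow_zero]
  · have hcos : -2 * Real.cos (Real.pi / (2 : ℕ)) = 0 := by simp
    have e1 : simpleCoroot M i (Finsupp.single j 1) = 0 := by rw [simpleCoroot_single, h2, hcos]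
    have e2 : simpleCoroot M j (Finsupp.single i 1) = 0 := by
      rw [simpleCoroot_single, M.symmetric, h2, hcos]
    rw [h2]
    refine LinearEquiv.ext fun v ↦ ?_
    simp only [geomReflection, pow_two, LinearEquiv.mul_apply, Module.reflection_apply, map_sub,
      map_smul, e1, e2, simpleCoroot_single_self, LinearEquiv.coe_one, id]
    module
  · have ht : 2 * Real.cos (2 * Real.pi / M i j) = simpleCoroot M i (Finsupp.single j 1) *
        simpleCoroot M j (Finsupp.single i 1) - 2 := by
      rw [simpleCoroot_single, simpleCoroot_single, M.symmetric j i, mul_div_assoc, Real.cos_two_mul]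
      ring
    refine LinearEquiv.ext fun v ↦ ?_
    rw [geomReflection, geomReflection, Module.reflection_mul_reflection_pow_apply _ _ _ _ _ ht]
    rcases chebyshev_S_eval_eq_zero h3 rfl with ⟨h, h'⟩ | ⟨h, h'⟩ <;> simp [h, h']

theorem simple_notMem_closure (cs : CoxeterSystem M W) {J : Set B} {i : B} (hi : i ∉ J) :
    cs.simple i ∉ Subgroup.closure (cs.simple '' J) := by
  intro h
  let ρ := cs.lift ⟨geomReflection M, geomReflection_isLiftable⟩
  have hρ (j : B) : ρ (cs.simple j) = geomReflection M j := cs.lift_apply_simple _ j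
  have fixes : ∀ w ∈ Subgroup.closure (cs.simple '' J), ∀ v, (ρ w v) i = v i := by
    intro w hw
    induction hw using Subgroup.closure_induction with
    | mem x hx =>
      obtain ⟨j, hj, rfl⟩ := hx
      intro v
      have hij : j ≠ i := by rintro rfl; exact hi hj
      rw [hρ]
      simp [geomReflection, Module.reflection_apply, hij]
    | one => simp
    | mul x y _ _ hx hy => intro v; rw [map_mul, LinearEquiv.mul_apply, hx, hy]
    | inv x _ hx =>
      intro v
      rw [← hx, ← LinearEquiv.mul_apply, ← map_mul]
      simp
  have := fixes _ h (Finsupp.single i 1)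
  rw [hρ] at this
  simp [geomReflection] at this
  norm_num at this

end GeometricRepresentation

section Exchange

/-- The action of a simple generator on pairs `(t, z)`, conjugating `t` by `sᵢ` and
flipping the sign `z` exactly when `t = sᵢ`. -/
noncomputable def signedConj (cs : CoxeterSystem M W) (i : B) : Function.End (W × ZMod 2) :=
  open Classical in
  fun p ↦ (cs.simple i * p.1 * cs.simple i, p.2 + if p.1 = cs.simple i then 1 else 0)

open Classical in
theorem prod_map_signedConj_apply (cs : CoxeterSystem M W) (ω : List B) (p : W × ZMod 2) :
    (ω.map (signedConj cs)).prod p =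
      (cs.wordProd ω * p.1 * (cs.wordProd ω)⁻¹, p.2 + ((cs.rightInvSeq ω).count p.1 : ZMod 2)) := by
  induction ω with
  | nil => simp [Function.End.one_def]
  | cons i ω ih =>
    rw [List.map_cons, List.prod_cons]
    change signedConj cs i ((ω.map (signedConj cs)).prod p) = _
    rw [ih]
    have key : cs.wordProd ω * p.1 * (cs.wordProd ω)⁻¹ = cs.simple i ↔
        (cs.wordProd ω)⁻¹ * cs.simple i * cs.wordProd ω = p.1 := by
      constructor
      · intro h; rw [← h]; group
      · intro h; rw [← h]; group
    simp only [signedConj, key, cs.wordProd_cons, CoxeterSystem.rightInvSeq, List.count_cons,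
      beq_iff_eq]
    refine Prod.ext ?_ ?_
    · simp [mul_assoc]
    · push_cast; ring

theorem even_count_leftInvSeq_alternatingWord [DecidableEq W] (cs : CoxeterSystem M W) (i j : B)
    (t : W) : Even ((cs.leftInvSeq (alternatingWord i j (2 * M i j))).count t) := by
  set m := M i j with hm
  set L := cs.leftInvSeq (alternatingWord i j (2 * m)) with hL
  have hlen : L.length = 2 * m := by simp [hL]
  have hdrop : L.drop m = L.take m := by
    apply List.ext_getElem
    · simp [hlen]; omega
    · intro k h1 h2
      simp only [List.length_drop, List.length_take, hlen] at h1 h2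
      simp only [List.getElem_drop, List.getElem_take, hL]
      rw [cs.getElem_leftInvSeq_alternatingWord _ _ _ _ (by omega),
        cs.getElem_leftInvSeq_alternatingWord _ _ _ _ (by omega)]
      rw [cs.prod_alternatingWord_eq_mul_pow, cs.prod_alternatingWord_eq_mul_pow]
      have e1 : ¬ Even (2 * (m + k) + 1) := by simp
      have e2 : ¬ Even (2 * k + 1) := by simp
      have d1 : (2 * (m + k) + 1) / 2 = m + k := by omega
      have d2 : (2 * k + 1) / 2 = k := by omega
      simp only [e1, e2, d1, d2, if_false, pow_add]
      simp [hm]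
  rw [← List.take_append_drop m L, List.count_append, hdrop]
  exact ⟨_, rfl⟩

theorem signedConj_isLiftable (cs : CoxeterSystem M W) : M.IsLiftable (signedConj cs) := by
  classical
  intro i j
  have hpow (m : ℕ) : (signedConj cs i * signedConj cs j) ^ m =
      (((alternatingWord j i (2 * m)).reverse).map (signedConj cs)).prod := by
    induction m with
    | zero => simp [alternatingWord]
    | succ m ih =>
      rw [pow_succ', ih, mul_add, mul_one, alternatingWord_succ, alternatingWord_succ]
      simp [mul_assoc]
  rw [hpow]
  funext p
  rw [prod_map_signedConj_apply, cs.rightInvSeq_reverse, List.count_reverse, M.symmetric i j]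
  have h1 : cs.wordProd (alternatingWord j i (2 * M j i)).reverse = 1 := by
    rw [cs.wordProd_reverse, cs.prod_alternatingWord_eq_mul_pow]
    simp
  have h2 := even_count_leftInvSeq_alternatingWord cs j i p.1
  rw [← ZMod.natCast_eq_zero_iff_even] at h2
  simp [h1, h2, Function.End.one_def]

theorem count_rightInvSeq_eq [DecidableEq W] (cs : CoxeterSystem M W) {ω ω' : List B}
    (h : cs.wordProd ω = cs.wordProd ω') (t : W) :
    ((cs.rightInvSeq ω).count t : ZMod 2) = (cs.rightInvSeq ω').count t := by
  let φ := cs.lift ⟨signedConj cs, signedConj_isLiftable cs⟩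
  have hφ (ω : List B) : φ (cs.wordProd ω) = (ω.map (signedConj cs)).prod := by
    rw [CoxeterSystem.wordProd, map_list_prod, List.map_map]
    congr 2
    funext j
    exact cs.lift_apply_simple _ j
  have := congrArg Prod.snd (congrFun (congrArg φ h) (t, 0))
  rw [hφ, hφ, prod_map_signedConj_apply, prod_map_signedConj_apply] at this
  convert this using 1 <;> simp <;> congr!

/-- The exchange condition, for words that need not be reduced. -/
theorem exists_eraseIdx_of_isRightDescent (cs : CoxeterSystem M W) (ω : List B) {i : B}
    (h : cs.IsRightDescent (cs.wordProd ω) i) :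
    ∃ k < ω.length, cs.wordProd ω * cs.simple i = cs.wordProd (ω.eraseIdx k) := by
  classical
  obtain ⟨τ, hτ, hτw⟩ := cs.exists_isReduced (cs.wordProd ω * cs.simple i)
  have hprod : cs.wordProd (τ.concat i) = cs.wordProd ω := by
    simp [cs.wordProd_append, List.concat_eq_append, ← hτw]
  have hred : cs.IsReduced (τ.concat i) := by
    rw [CoxeterSystem.IsReduced, hprod, ← cs.isRightDescent_iff.mp h, hτw, hτ.eq]
    simp
  have hmem : cs.simple i ∈ cs.rightInvSeq (τ.concat i) := by
    rw [cs.rightInvSeq_concat]; simp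
  have hcount := count_rightInvSeq_eq cs hprod (cs.simple i)
  rw [List.count_eq_one_of_mem hred.nodup_rightInvSeq hmem] at hcount
  have hmem' : cs.simple i ∈ cs.rightInvSeq ω := by
    by_contra hn
    rw [List.count_eq_zero_of_not_mem hn] at hcount
    simp at hcount
  obtain ⟨k, hk, hk'⟩ := List.mem_iff_getElem.mp hmem'
  refine ⟨k, by simpa using hk, ?_⟩
  rw [← cs.wordProd_mul_getD_rightInvSeq, List.getD_eq_getElem _ _ hk, hk']

/-- The exchange condition for a concatenation of two words. -/
theorem exchange_append (cs : CoxeterSystem M W) (ρ σ : List B) {i : B}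
    (h : cs.IsRightDescent (cs.wordProd ρ * cs.wordProd σ) i) :
    (∃ k < ρ.length, cs.wordProd ρ * cs.wordProd σ * cs.simple i =
      cs.wordProd (ρ.eraseIdx k) * cs.wordProd σ) ∨
    ∃ k < σ.length, cs.wordProd σ * cs.simple i = cs.wordProd (σ.eraseIdx k) := by
  rw [← cs.wordProd_append] at h
  obtain ⟨k, hk, hk'⟩ := exists_eraseIdx_of_isRightDescent cs _ h
  rw [List.length_append] at hk
  rcases lt_or_ge k ρ.length with hlt | hge
  · left
    refine ⟨k, hlt, ?_⟩
    rw [← cs.wordProd_append, hk', List.eraseIdx_append_of_lt_length hlt, cs.wordProd_append]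
  · right
    refine ⟨k - ρ.length, by omega, ?_⟩
    rw [List.eraseIdx_append_of_length_le hge, cs.wordProd_append, cs.wordProd_append,
      mul_assoc] at hk'
    exact mul_left_cancel hk'

end Exchange

section Parabolic

theorem wordProd_mem_closure (cs : CoxeterSystem M W) {K : Set B} {ω : List B}
    (h : ∀ i ∈ ω, i ∈ K) : cs.wordProd ω ∈ Subgroup.closure (cs.simple '' K) := by
  apply Subgroup.list_prod_mem
  intro x hx
  obtain ⟨i, hi, rfl⟩ := List.mem_map.mp hx
  exact Subgroup.subset_closure ⟨i, h i hi, rfl⟩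

theorem exists_word_of_mem_closure (cs : CoxeterSystem M W) {K : Set B} {x : W}
    (h : x ∈ Subgroup.closure (cs.simple '' K)) :
    ∃ ω : List B, (∀ i ∈ ω, i ∈ K) ∧ cs.wordProd ω = x := by
  induction h using Subgroup.closure_induction with
  | mem x hx =>
    obtain ⟨i, hi, rfl⟩ := hx
    exact ⟨[i], by simpa, by simp⟩
  | one => exact ⟨[], by simp, by simp⟩
  | mul x y _ _ hx hy =>
    obtain ⟨ω, hω, rfl⟩ := hx
    obtain ⟨τ, hτ, rfl⟩ := hy
    exact ⟨ω ++ τ, by simpa [or_imp, forall_and] using ⟨hω, hτ⟩, cs.wordProd_append _ _⟩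
  | inv x _ hx =>
    obtain ⟨ω, hω, rfl⟩ := hx
    exact ⟨ω.reverse, by simpa, cs.wordProd_reverse _⟩

/-- A word in `K` can be shortened to a reduced word in `K` with the same product. -/
theorem exists_isReduced_of_word (cs : CoxeterSystem M W) {K : Set B} (ω : List B)
    (h : ∀ i ∈ ω, i ∈ K) :
    ∃ τ : List B, (∀ i ∈ τ, i ∈ K) ∧ cs.IsReduced τ ∧ cs.wordProd τ = cs.wordProd ω := by
  induction ω using List.reverseRecOn with
  | nil => exact ⟨[], by simp, by simp [CoxeterSystem.IsReduced], rfl⟩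
  | append_singleton ω i ih =>
    obtain ⟨τ, hτK, hτ, hτω⟩ := ih fun j hj ↦ h j (by simp [hj])
    have hi : i ∈ K := h i (by simp)
    rw [cs.wordProd_append, ← hτω, cs.wordProd_singleton]
    by_cases hd : cs.IsRightDescent (cs.wordProd τ) i
    · obtain ⟨k, hk, hk'⟩ := exists_eraseIdx_of_isRightDescent cs τ hd
      refine ⟨τ.eraseIdx k, fun j hj ↦ hτK j (List.mem_of_mem_eraseIdx hj), ?_, hk'.symm⟩
      have := cs.isRightDescent_iff.mp hd
      rw [hk', hτ.eq] at this
      rw [CoxeterSystem.IsReduced, List.length_eraseIdx_of_lt hk]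
      omega
    · refine ⟨τ ++ [i], ?_, ?_, by simp [cs.wordProd_append]⟩
      · intro j hj
        rcases List.mem_append.mp hj with hj | hj
        · exact hτK j hj
        · rwa [List.mem_singleton.mp hj]
      · rw [CoxeterSystem.IsReduced, cs.wordProd_append, cs.wordProd_singleton,
          cs.not_isRightDescent_iff.mp hd, hτ.eq]
        simp

theorem exists_isReduced_of_mem_closure (cs : CoxeterSystem M W) {K : Set B} {x : W}
    (h : x ∈ Subgroup.closure (cs.simple '' K)) :
    ∃ ω : List B, (∀ i ∈ ω, i ∈ K) ∧ cs.IsReduced ω ∧ cs.wordProd ω = x := by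
  obtain ⟨ω, hω, rfl⟩ := exists_word_of_mem_closure cs h
  exact exists_isReduced_of_word cs ω hω

theorem IsMinCosetRep.length_mul_wordProd {cs : CoxeterSystem M W} {K : Set B} {a : W}
    (ha : IsMinCosetRep cs K a) (ω : List B) (hK : ∀ i ∈ ω, i ∈ K) (hω : cs.IsReduced ω) :
    cs.length (a * cs.wordProd ω) = cs.length a + ω.length := by
  induction ω using List.reverseRecOn with
  | nil => simp
  | append_singleton ω i ih =>
    have hω' : cs.IsReduced ω := by simpa using hω.take ω.length
    have hK' : ∀ j ∈ ω, j ∈ K := fun j hj ↦ hK j (by simp [hj])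
    specialize ih hK' hω'
    rw [cs.wordProd_append, cs.wordProd_singleton, ← mul_assoc, List.length_append,
      List.length_singleton]
    by_cases hd : cs.IsRightDescent (a * cs.wordProd ω) i
    · exfalso
      obtain ⟨α, hα, rfl⟩ := cs.exists_isReduced a
      rcases exchange_append cs α ω hd with ⟨k, hk, h⟩ | ⟨k, hk, h⟩
      · have hmem : cs.wordProd ω * cs.simple i * (cs.wordProd ω)⁻¹ ∈
            Subgroup.closure (cs.simple '' K) :=
          mul_mem (mul_mem (wordProd_mem_closure cs hK')
            (Subgroup.subset_closure ⟨i, hK i (by simp), rfl⟩))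
            (inv_mem (wordProd_mem_closure cs hK'))
        have h1 := ha _ hmem
        rw [← mul_assoc, ← mul_assoc, h, mul_inv_cancel_right, hα.eq] at h1
        have h2 := cs.length_wordProd_le (α.eraseIdx k)
        rw [List.length_eraseIdx_of_lt hk] at h2
        omega
      · have h1 := cs.length_wordProd_le (ω.eraseIdx k)
        rw [← h, List.length_eraseIdx_of_lt hk] at h1
        have h2 := hω.eq
        rw [cs.wordProd_append, cs.wordProd_singleton, List.length_append,
          List.length_singleton] at h2
        omega
    · rw [cs.not_isRightDescent_iff.mp hd, ih, add_assoc]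

theorem IsMinCosetRep.length_mul {cs : CoxeterSystem M W} {K : Set B} {a x : W}
    (ha : IsMinCosetRep cs K a) (hx : x ∈ Subgroup.closure (cs.simple '' K)) :
    cs.length (a * x) = cs.length a + cs.length x := by
  obtain ⟨ω, hK, hω, rfl⟩ := exists_isReduced_of_mem_closure cs hx
  rw [ha.length_mul_wordProd ω hK hω, hω.eq]

theorem exists_isMinCosetRep (cs : CoxeterSystem M W) (K : Set B) (a : W) :
    ∃ x ∈ Subgroup.closure (cs.simple '' K), IsMinCosetRep cs K (a * x) := by
  let H := Subgroup.closure (cs.simple '' K)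
  let f : H → ℕ := fun x ↦ cs.length (a * x)
  let x := Function.argmin f
  refine ⟨x, x.2, fun y hy ↦ ?_⟩
  rw [mul_assoc]
  exact Function.argmin_le f (⟨x * y, mul_mem x.2 hy⟩ : H)

theorem isMinCosetRep_of_forall_not_isRightDescent (cs : CoxeterSystem M W) {K : Set B} {a : W}
    (h : ∀ i ∈ K, ¬ cs.IsRightDescent a i) : IsMinCosetRep cs K a := by
  obtain ⟨x, hx, hmin⟩ := exists_isMinCosetRep cs K a
  obtain ⟨ω, hK, hω, hωx⟩ := exists_isReduced_of_mem_closure cs (inv_mem hx)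
  rcases List.eq_nil_or_concat ω with rfl | ⟨τ, i, rfl⟩
  · have : x = 1 := by simpa using hωx.symm
    simpa [this] using hmin
  · exfalso
    have hi : i ∈ K := hK i (by simp)
    apply h i hi
    have h1 := hmin.length_mul (inv_mem hx)
    have h2 := hmin.length_mul (mul_mem (inv_mem hx) (Subgroup.subset_closure ⟨i, hi, rfl⟩))
    rw [mul_inv_cancel_right] at h1
    rw [← mul_assoc, mul_inv_cancel_right, ← hωx, List.concat_eq_append, cs.wordProd_append,
      cs.wordProd_singleton, cs.simple_mul_simple_cancel_right] at h2
    have h3 := cs.length_wordProd_le τ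
    rw [← hωx, hω.eq] at h1
    simp only [List.length_concat] at h1
    rw [CoxeterSystem.IsRightDescent]
    omega

/-- If every element of `K` is a right descent of `w`, multiplying `w` on the right by an
element of `W_K` lowers the length as much as possible. -/
theorem length_mul_wordProd_add_of_descents (cs : CoxeterSystem M W) {K : Set B} {w : W}
    (hw : ∀ i ∈ K, cs.IsRightDescent w i) (ω : List B) (hK : ∀ i ∈ ω, i ∈ K)
    (hω : cs.IsReduced ω) : cs.length (w * cs.wordProd ω) + ω.length = cs.length w := by
  induction ω with
  | nil => simp
  | cons i ω ih =>
    have hω' : cs.IsReduced ω := by simpa using hω.drop 1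
    specialize ih (fun j hj ↦ hK j (by simp [hj])) hω'
    have hi := hw i (hK i (by simp))
    obtain ⟨ρ, hρ, hρw⟩ := cs.exists_isReduced (w * cs.wordProd ω)
    have hweq : w = cs.wordProd ρ * cs.wordProd ω.reverse := by
      rw [← hρw, cs.wordProd_reverse, mul_inv_cancel_right]
    have hlow := cs.length_le_length_mul_add_right w (cs.wordProd (i :: ω))
    rw [hω.eq] at hlow
    refine le_antisymm ?_ hlow
    rw [hρw, hρ.eq] at ih
    rw [hweq] at hi
    rcases exchange_append cs ρ ω.reverse hi with ⟨k, hk, h⟩ | ⟨k, hk, h⟩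
    · have h2 : w * cs.wordProd (i :: ω) = cs.wordProd (ρ.eraseIdx k) := by
        rw [cs.wordProd_cons, ← mul_assoc, hweq, h, cs.wordProd_reverse, inv_mul_cancel_right]
      have h3 := cs.length_wordProd_le (ρ.eraseIdx k)
      rw [List.length_eraseIdx_of_lt hk] at h3
      rw [h2, List.length_cons]
      omega
    · exfalso
      have h1 := cs.length_wordProd_le (ω.reverse.eraseIdx k)
      rw [← h, List.length_eraseIdx_of_lt hk, ← cs.length_inv, cs.wordProd_reverse, mul_inv_rev,
        inv_inv, cs.inv_simple, ← cs.wordProd_cons, hω.eq] at h1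
      simp at h1 hk
      omega

theorem IsLongestIn.isRightDescent {cs : CoxeterSystem M W} {K : Set B} {w : W}
    (hw : IsLongestIn cs K w) {i : B} (hi : i ∈ K) : cs.IsRightDescent w i :=
  lt_of_le_of_ne (hw.2 _ (mul_mem hw.1 (Subgroup.subset_closure ⟨i, hi, rfl⟩)))
    (cs.length_mul_simple_ne w i)

theorem IsLongestIn.length_mul_add {cs : CoxeterSystem M W} {K : Set B} {w x : W}
    (hw : IsLongestIn cs K w) (hx : x ∈ Subgroup.closure (cs.simple '' K)) :
    cs.length (w * x) + cs.length x = cs.length w := by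
  obtain ⟨ω, hK, hω, rfl⟩ := exists_isReduced_of_mem_closure cs hx
  rw [hω.eq]
  exact length_mul_wordProd_add_of_descents cs (fun _ ↦ hw.isRightDescent) ω hK hω

theorem not_isRightDescent_of_mem_closure (cs : CoxeterSystem M W) {J : Set B} {a : W}
    (ha : a ∈ Subgroup.closure (cs.simple '' J)) {i : B} (hi : i ∉ J) :
    ¬ cs.IsRightDescent a i := by
  intro hd
  obtain ⟨ω, hJ, rfl⟩ := exists_word_of_mem_closure cs ha
  obtain ⟨k, -, h⟩ := exists_eraseIdx_of_isRightDescent cs ω hd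
  apply simple_notMem_closure cs hi
  rw [← inv_mul_cancel_left (cs.wordProd ω) (cs.simple i), h]
  exact mul_mem (inv_mem ha)
    (wordProd_mem_closure cs fun j hj ↦ hJ j (List.mem_of_mem_eraseIdx hj))

theorem isMinCosetRep_longest_mul_longest {cs : CoxeterSystem M W} {J J' : Set B} {wJ wI : W}
    (hJ : IsLongestIn cs J wJ) (hI : IsLongestIn cs (J ∩ J') wI) :
    IsMinCosetRep cs J' (wJ * wI) := by
  have hsub : Subgroup.closure (cs.simple '' (J ∩ J')) ≤ Subgroup.closure (cs.simple '' J) :=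
    Subgroup.closure_mono (Set.image_mono Set.inter_subset_left)
  refine isMinCosetRep_of_forall_not_isRightDescent cs fun i hi ↦ ?_
  by_cases hiJ : i ∈ J
  · have h1 := hJ.length_mul_add (hsub hI.1)
    have h2 := hJ.length_mul_add
      (mul_mem (hsub hI.1) (Subgroup.subset_closure (Set.mem_image_of_mem cs.simple hiJ)))
    have h3 := cs.isRightDescent_iff.mp (hI.isRightDescent ⟨hiJ, hi⟩)
    rw [← mul_assoc] at h2
    rw [CoxeterSystem.IsRightDescent]
    omega
  · exact not_isRightDescent_of_mem_closure cs (mul_mem hJ.1 (hsub hI.1)) hiJ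

end Parabolic

/-- For `w = w₀(J)·w₀(J∩J')·w₀(J')` in a finite Coxeter group: the product
`(w₀(J)w₀(J∩J'))·w₀(J')` is length-additive, `J' ⊆ D_R(w)`, and the parabolic decomposition
of `w` with respect to `J'` is `w^{J'} = w₀(J)w₀(J∩J')`, `w_{J'} = w₀(J')`. -/
theorem stmt19 [Finite W] (cs : CoxeterSystem M W) (J J' : Set B) (wJ wI wJ' : W)
    (hJ : IsLongestIn cs J wJ) (hI : IsLongestIn cs (J ∩ J') wI)
    (hJ' : IsLongestIn cs J' wJ') :
    cs.length (wJ * wI * wJ') = cs.length (wJ * wI) + cs.length wJ' ∧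
    (∀ i ∈ J', cs.IsRightDescent (wJ * wI * wJ') i) ∧
    IsPDecomp cs J' (wJ * wI * wJ') (wJ * wI) wJ' := by
  have hmin := isMinCosetRep_longest_mul_longest hJ hI
  have hadd := hmin.length_mul hJ'.1
  refine ⟨hadd, fun i hi ↦ ?_, rfl, hJ'.1, hmin⟩
  have h1 := cs.length_mul_le (wJ * wI) (wJ' * cs.simple i)
  have h2 : cs.length (wJ' * cs.simple i) < cs.length wJ' := hJ'.isRightDescent hi
  rw [← mul_assoc] at h1
  rw [CoxeterSystem.IsRightDescent]
  omega
end
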